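/- Let N ≥ 2, let Ω ⊂ ℝ^N be a bounded open set with 0 < H^{N-1}(∂Ω) < ∞, and let R : ℝ^N → ℝ^N be a C¹ vector field with bounded derivative. For a bounded open set D with 0 < H^{N-1}(∂D) < ∞ and a Lipschitz function v : ℝ^N → ℝ with ∫_{∂D}|v| dH^{N-1} > 0, write Q_D(v) := (∫_D ‖∇v‖ dx + ∫_D |v| dx) / ∫_{∂D} |v| dH^{N-1}. Then there exist C > 0 and δ₀ > 0 such that for all δ with |δ| ≤ δ₀ and every Lipschitz function u : ℝ^N → ℝ with ∫_{∂Ω} |u| dH^{N-1} > 0, setting Ω_δ := T_δ(Ω) and v := u ∘ T_δ^{-1} (which is Lipschitz), one has ∫_{∂Ω_δ}|v| dH^{N-1} > 0 and (1 − C|δ|) Q_Ω(u) ≤ Q_{Ω_δ}(v) ≤ (1 + C|δ|) Q_Ω(u). -/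

import Mathlib

open MeasureTheory Filter Topology
open scoped ENNReal NNReal

/-- The trace quotient `Q_D(v) = (∫_D ‖∇v‖ + ∫_D |v|) / ∫_{∂D} |v| dH^{N-1}`
of a (Lipschitz) function `v : ℝ^N → ℝ` on a bounded open set `D`. -/
noncomputable def traceQuotient {N : ℕ} (D : Set (EuclideanSpace ℝ (Fin N)))
    (v : EuclideanSpace ℝ (Fin N) → ℝ) : ℝ :=
  ((∫ x in D, ‖fderiv ℝ v x‖) + ∫ x in D, |v x|) /
    ∫ x in frontier D, |v x| ∂(μH[(N : ℝ) - 1])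

/-- If a homeomorphism `e` increases `μ` by at most the factor `c`, then transporting a nonnegative
integrable function along `e` increases its integral by at most `c`. -/
theorem integral_image_le {E : Type*} [TopologicalSpace E] [MeasurableSpace E] [BorelSpace E]
    {μ : Measure E} (e : E ≃ₜ E) {c : ℝ≥0} (hc : ∀ s, μ (e '' s) ≤ c * μ s)
    {A : Set E} {f : E → ℝ} (hf0 : 0 ≤ f) (hf : IntegrableOn f A μ) :
    IntegrableOn (f ∘ e.symm) (e '' A) μ ∧
      ∫ y in e '' A, (f ∘ e.symm) y ∂μ ≤ c * ∫ x in A, f x ∂μ := by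
  have hle : μ.restrict (e '' A) ≤ c • (μ.restrict A).map e := by
    refine Measure.le_iff.2 fun s hs => ?_
    rw [Measure.restrict_apply hs, Measure.smul_apply, Measure.map_apply e.measurable hs,
      Measure.restrict_apply (e.measurable hs), Set.inter_comm, ← Set.image_inter_preimage,
      Set.inter_comm A]
    exact hc _
  have hcomp : (f ∘ e.symm) ∘ e = f := by ext x; simp
  have hint : Integrable (f ∘ e.symm) ((μ.restrict A).map e) := by
    refine (integrable_map_equiv e.toMeasurableEquiv (f ∘ e.symm)).2 ?_
    change Integrable ((f ∘ e.symm) ∘ e) (μ.restrict A)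
    rwa [hcomp]
  have hint' : Integrable (f ∘ e.symm) (c • (μ.restrict A).map e) := hint.smul_measure_nnreal
  refine ⟨hint'.mono_measure hle, ?_⟩
  calc ∫ y in e '' A, (f ∘ e.symm) y ∂μ
      ≤ ∫ y, (f ∘ e.symm) y ∂(c • (μ.restrict A).map e) :=
        integral_mono_measure hle (ae_of_all _ fun y => hf0 (e.symm y)) hint'
    _ = c * ∫ x in A, f x ∂μ := by
        rw [integral_smul_nnreal_measure, NNReal.smul_def, smul_eq_mul]
        congr 1
        have := integral_map_equiv (μ := μ.restrict A) e.toMeasurableEquiv (f ∘ e.symm)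
        simpa [Function.comp_def] using this

/-- An `a`-Lipschitz self-map of `ℝ^n` increases Lebesgue measure by at most `a ^ n`. -/
theorem volume_image_le {n : ℕ} {f : EuclideanSpace ℝ (Fin n) → EuclideanSpace ℝ (Fin n)}
    {a : ℝ≥0} (hf : LipschitzWith a f) (s : Set (EuclideanSpace ℝ (Fin n))) :
    volume (f '' s) ≤ (a ^ n : ℝ≥0) * volume s := by
  rw [Measure.isAddLeftInvariant_eq_smul (volume : Measure (EuclideanSpace ℝ (Fin n))) μH[(n : ℝ)]]
  have h := hf.hausdorffMeasure_image_le (Nat.cast_nonneg n) s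
  rw [ENNReal.rpow_natCast] at h
  rw [Measure.smul_apply, Measure.smul_apply, ENNReal.smul_def, ENNReal.smul_def,
    smul_eq_mul, smul_eq_mul, mul_left_comm, ENNReal.coe_pow]
  gcongr

/-- A bi-Lipschitz diffeomorphism with constants `a` and `b` changes the trace quotient by at most
the factor `(a * b) ^ n`. -/
theorem traceQuotient_image_le {n : ℕ} (hn : 1 ≤ n) {Ω : Set (EuclideanSpace ℝ (Fin n))}
    (hΩo : IsOpen Ω) (hΩb : Bornology.IsBounded Ω)
    (hΩ : μH[(n : ℝ) - 1] (frontier Ω) < ⊤)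
    (e : EuclideanSpace ℝ (Fin n) ≃ₜ EuclideanSpace ℝ (Fin n)) {a b : ℝ≥0}
    (ha : LipschitzWith a e) (hb : LipschitzWith b e.symm) (hb1 : 1 ≤ b)
    (hed : Differentiable ℝ e) (hesd : Differentiable ℝ e.symm)
    {u : EuclideanSpace ℝ (Fin n) → ℝ} {K : ℝ≥0} (hu : LipschitzWith K u)
    (hpos : 0 < ∫ x in frontier Ω, |u x| ∂(μH[(n : ℝ) - 1])) :
    (0 < ∫ x in frontier (e '' Ω), |(u ∘ e.symm) x| ∂(μH[(n : ℝ) - 1])) ∧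
      traceQuotient (e '' Ω) (u ∘ e.symm) ≤ (a * b) ^ n * traceQuotient Ω u := by
  obtain ⟨m, rfl⟩ : ∃ m, n = m + 1 := ⟨n - 1, by omega⟩
  have hd : ((m + 1 : ℕ) : ℝ) - 1 = m := by simp
  rw [traceQuotient, traceQuotient]
  rw [hd] at hΩ hpos ⊢
  have hH : ∀ (g : EuclideanSpace ℝ (Fin (m + 1)) → EuclideanSpace ℝ (Fin (m + 1))) (k : ℝ≥0),
      LipschitzWith k g → ∀ s, μH[(m : ℝ)] (g '' s) ≤ (k ^ m : ℝ≥0) * μH[(m : ℝ)] s := by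
    intro g k hg s
    have h := hg.hausdorffMeasure_image_le (Nat.cast_nonneg m) s
    rwa [ENNReal.rpow_natCast, ← ENNReal.coe_pow] at h
  have hbdd : ∀ {A : Set (EuclideanSpace ℝ (Fin (m + 1)))}
      {μ : Measure (EuclideanSpace ℝ (Fin (m + 1)))}, MeasurableSet A →
      Bornology.IsBounded A → μ A < ⊤ → IntegrableOn (fun x => |u x|) A μ := by
    intro A μ hAm hA hμ
    obtain ⟨M, hM⟩ := (hu.isBounded_image hA).exists_norm_le
    refine IntegrableOn.of_bound hμ hu.continuous.abs.aestronglyMeasurable M ?_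
    exact ae_restrict_of_forall_mem hAm fun x hx => by
      simpa using hM (u x) (Set.mem_image_of_mem u hx)
  have hv : IntegrableOn (fun x => |u x|) Ω := hbdd hΩo.measurableSet hΩb hΩb.measure_lt_top
  have hfr : IntegrableOn (fun x => |u x|) (frontier Ω) μH[(m : ℝ)] :=
    hbdd isClosed_frontier.measurableSet (hΩb.closure.subset frontier_subset_closure) hΩ
  have hg : IntegrableOn (fun x => ‖fderiv ℝ u x‖) Ω :=
    IntegrableOn.of_bound hΩb.measure_lt_top (measurable_fderiv ℝ u).norm.aestronglyMeasurable K
      (ae_of_all _ fun x => by simpa using norm_fderiv_le_of_lipschitz ℝ hu)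
  have h0 : (0 : EuclideanSpace ℝ (Fin (m + 1)) → ℝ) ≤ fun x => |u x| := fun x => abs_nonneg _
  have h0' : (0 : EuclideanSpace ℝ (Fin (m + 1)) → ℝ) ≤ fun x => ‖fderiv ℝ u x‖ :=
    fun x => norm_nonneg _
  obtain ⟨-, I1⟩ := integral_image_le e (volume_image_le ha) h0 hv
  obtain ⟨J2, I2⟩ := integral_image_le e (volume_image_le ha) h0' hg
  obtain ⟨J3, -⟩ := integral_image_le e (hH _ _ ha) h0 hfr
  obtain ⟨-, I4⟩ := integral_image_le e.symm (hH _ _ hb) (fun x => abs_nonneg _) J3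
  have I5 : ∫ y in e '' Ω, ‖fderiv ℝ (u ∘ e.symm) y‖ ≤
      b * ∫ y in e '' Ω, ((fun x => ‖fderiv ℝ u x‖) ∘ e.symm) y := by
    rw [← integral_const_mul]
    refine integral_mono_of_nonneg (ae_of_all _ fun x => norm_nonneg _) (J2.const_mul _)
      (ae_of_all _ fun y => ?_)
    simp only [Function.comp_apply]
    by_cases hdu : DifferentiableAt ℝ u (e.symm y)
    · rw [fderiv_comp _ hdu (hesd y), mul_comm]
      refine (ContinuousLinearMap.opNorm_comp_le _ _).trans ?_
      gcongr
      exact norm_fderiv_le_of_lipschitz ℝ hb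
    · rw [fderiv_zero_of_not_differentiableAt, norm_zero]
      · positivity
      · intro h
        apply hdu
        have h' : DifferentiableAt ℝ (u ∘ e.symm) (e (e.symm y)) := by simpa using h
        have := h'.comp (e.symm y) (hed (e.symm y))
        simpa [Function.comp_def] using this
  have himg : e.symm '' (e '' frontier Ω) = frontier Ω := by rw [← Set.image_comp]; simp
  rw [himg] at I4
  have hcomp : (fun x => |u (e.symm x)|) ∘ e.symm.symm = fun x => |u x| := by
    ext x; simp
  rw [hcomp] at I4
  rw [← e.image_frontier]
  change ∫ y in e '' Ω, |(u ∘ e.symm) y| ≤ _ at I1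
  change _ ≤ _ * ∫ y in e '' frontier Ω, |(u ∘ e.symm) y| ∂μH[(m : ℝ)] at I4
  set D := ∫ x in frontier Ω, |u x| ∂μH[(m : ℝ)]
  set D' := ∫ x in e '' frontier Ω, |(u ∘ e.symm) x| ∂μH[(m : ℝ)]
  set G := ∫ x in Ω, ‖fderiv ℝ u x‖
  set V := ∫ x in Ω, |u x|
  have hG : 0 ≤ G := integral_nonneg h0'
  have hV : 0 ≤ V := integral_nonneg h0
  have hD' : 0 < D' := pos_of_mul_pos_right (hpos.trans_le I4) (by positivity)
  refine ⟨hD', ?_⟩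
  have hb1' : (1 : ℝ) ≤ b := hb1
  rw [← mul_div_assoc, div_le_div_iff₀ hD' hpos]
  push_cast at I1 I2 I4
  calc _ ≤ (b * (a ^ (m + 1) * G) + b * (a ^ (m + 1) * V)) * (b ^ m * D') := by
        gcongr
        · exact I5.trans (by gcongr)
        · exact I1.trans (le_mul_of_one_le_left (by positivity) hb1')
    _ = _ := by ring

theorem one_add_pow_le {s : ℝ} (hs0 : 0 ≤ s) (hs1 : s ≤ 1) (n : ℕ) :
    (1 + s) ^ n ≤ 1 + 3 ^ n * s := by
  induction n with
  | zero => simpa using hs0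
  | succ n ih =>
    have h3 : (1 : ℝ) ≤ 3 ^ n := one_le_pow₀ (by norm_num)
    calc (1 + s) ^ (n + 1) ≤ (1 + 3 ^ n * s) * (1 + s) := by
          rw [pow_succ]; gcongr
      _ ≤ 1 + 3 ^ (n + 1) * s := by
          have := mul_le_mul_of_nonneg_left hs1 (by positivity : 0 ≤ 3 ^ n * s)
          have := mul_le_mul_of_nonneg_right h3 hs0
          rw [pow_succ]; nlinarith

/-- A perturbation of the identity by a map with derivative at most `t < 1` is a bi-Lipschitz
diffeomorphism. -/
theorem exists_homeomorph_id_add {E : Type*} [NormedAddCommGroup E] [NormedSpace ℝ E]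
    [CompleteSpace E] {g : E → E} (hg : Differentiable ℝ g) {t : ℝ≥0} (ht : t < 1)
    (hgt : ∀ x, ‖fderiv ℝ g x‖₊ ≤ t) :
    ∃ e : E ≃ₜ E, (∀ x, e x = x + g x) ∧ LipschitzWith (1 + t) e ∧
      LipschitzWith (1 - t)⁻¹ e.symm ∧ Differentiable ℝ e ∧ Differentiable ℝ e.symm := by
  have hL : LipschitzWith t g := lipschitzWith_of_nnnorm_fderiv_le hg hgt
  have happ : ApproximatesLinearOn (fun x => x + g x)
      ((ContinuousLinearEquiv.refl ℝ E : E ≃L[ℝ] E) : E →L[ℝ] E) Set.univ t := by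
    intro x _ y _
    simpa [add_sub_add_comm] using hL.norm_sub_le x y
  have hc : Subsingleton E ∨
      t < ‖(((ContinuousLinearEquiv.refl ℝ E).symm : E ≃L[ℝ] E) : E →L[ℝ] E)‖₊⁻¹ := by
    rcases subsingleton_or_nontrivial E with h | h
    · exact Or.inl h
    · refine Or.inr ?_
      have : ‖(((ContinuousLinearEquiv.refl ℝ E).symm : E ≃L[ℝ] E) : E →L[ℝ] E)‖₊ = 1 := by
        ext; simp
      rwa [this, inv_one]
  let e : E ≃ₜ E := happ.toHomeomorph _ hc
  have he : ∀ x, e x = x + g x := fun x => rfl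
  have hed : Differentiable ℝ e := differentiable_id.add hg
  have hanti : AntilipschitzWith (1 - t)⁻¹ e := by
    have := (AntilipschitzWith.id (α := E)).add_lipschitzWith hL (by simpa using ht)
    simp only [inv_one] at this
    exact this
  refine ⟨e, he, LipschitzWith.id.add hL, hanti.to_rightInverse e.apply_symm_apply, hed, ?_⟩
  intro y
  set x := e.symm y
  have hlt : ‖-fderiv ℝ g x‖ < 1 := by
    rw [norm_neg]; exact (NNReal.coe_le_coe.2 (hgt x)).trans_lt ht
  obtain ⟨w, hw⟩ := isUnit_one_sub_of_norm_lt_one hlt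
  let f' : E ≃L[ℝ] E := ContinuousLinearEquiv.unitsEquiv ℝ E w
  have hf' : (f' : E →L[ℝ] E) = ContinuousLinearMap.id ℝ E + fderiv ℝ g x := by
    have : (f' : E →L[ℝ] E) = w := by ext; rfl
    rw [this, hw, sub_neg_eq_add]; rfl
  have hfd : HasFDerivAt e (f' : E →L[ℝ] E) x := by
    rw [hf']; exact (hasFDerivAt_id x).add (hg x).hasFDerivAt
  exact (HasFDerivAt.of_local_left_inverse e.symm.continuous.continuousAt hfd
    (Filter.Eventually.of_forall e.apply_symm_apply)).differentiableAt

/-- For a `C¹` vector field `R` with bounded derivative and `T_δ(x) = x + δ R(x)`,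
there are `C > 0` and `δ₀ > 0` such that for `|δ| ≤ δ₀` and every Lipschitz
`u : ℝ^N → ℝ` with positive boundary integral on `∂Ω`, the function
`v = u ∘ T_δ⁻¹` has positive boundary integral on `∂Ω_δ` and
`(1 − C|δ|) Q_Ω(u) ≤ Q_{Ω_δ}(v) ≤ (1 + C|δ|) Q_Ω(u)`, where `Ω_δ = T_δ(Ω)`. -/
theorem traceQuotient_comparison
    (N : ℕ) (hN : 2 ≤ N) (Ω : Set (EuclideanSpace ℝ (Fin N)))
    (hΩo : IsOpen Ω) (hΩb : Bornology.IsBounded Ω)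
    (hH0 : 0 < μH[(N : ℝ) - 1] (frontier Ω))
    (hH1 : μH[(N : ℝ) - 1] (frontier Ω) < ⊤)
    (R : EuclideanSpace ℝ (Fin N) → EuclideanSpace ℝ (Fin N))
    (hR : ContDiff ℝ 1 R)
    (hRb : ∃ M : ℝ, ∀ x, ‖fderiv ℝ R x‖ ≤ M) :
    ∃ C > (0 : ℝ), ∃ δ₀ > (0 : ℝ), ∀ δ : ℝ, |δ| ≤ δ₀ →
      ∀ (u : EuclideanSpace ℝ (Fin N) → ℝ) (K : ℝ≥0), LipschitzWith K u →
        0 < ∫ x in frontier Ω, |u x| ∂(μH[(N : ℝ) - 1]) →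
        (0 < ∫ x in frontier ((fun x => x + δ • R x) '' Ω),
            |(u ∘ Function.invFun (fun x : EuclideanSpace ℝ (Fin N) => x + δ • R x)) x|
              ∂(μH[(N : ℝ) - 1])) ∧
        (1 - C * |δ|) * traceQuotient Ω u ≤
          traceQuotient ((fun x => x + δ • R x) '' Ω)
            (u ∘ Function.invFun (fun x : EuclideanSpace ℝ (Fin N) => x + δ • R x)) ∧
        traceQuotient ((fun x => x + δ • R x) '' Ω)
            (u ∘ Function.invFun (fun x : EuclideanSpace ℝ (Fin N) => x + δ • R x)) ≤
          (1 + C * |δ|) * traceQuotient Ω u := by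
  obtain ⟨M₀, hM₀⟩ := hRb
  set M : ℝ≥0 := ⟨|M₀| + 1, by positivity⟩
  have hM0 : (0 : ℝ) < M := by show 0 < |M₀| + 1; positivity
  have hRM : ∀ x, ‖fderiv ℝ R x‖ ≤ M := fun x =>
    (hM₀ x).trans ((le_abs_self _).trans (by show |M₀| ≤ |M₀| + 1; linarith))
  refine ⟨3 ^ N * (4 * M), by positivity, 1 / (4 * M), by positivity, fun δ hδ u K hu hpos => ?_⟩
  set t : ℝ≥0 := ‖δ‖₊ * M with ht
  have htδ : (t : ℝ) = |δ| * M := by simp [ht]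
  have ht4 : (t : ℝ) ≤ 1 / 4 := by
    rw [htδ]
    rw [le_div_iff₀ (by positivity)] at hδ
    linarith
  have ht1 : t < 1 := by
    rw [← NNReal.coe_lt_coe, NNReal.coe_one]; linarith
  have hRd : Differentiable ℝ R := hR.differentiable one_ne_zero
  obtain ⟨e, he, ha, hb, hed, hesd⟩ := exists_homeomorph_id_add (g := fun x => δ • R x)
    (hRd.const_smul δ) ht1 (fun x => by
      rw [fderiv_fun_const_smul (hRd x), nnnorm_smul, ht]
      gcongr
      exact hRM x)
  have heq : (fun x : EuclideanSpace ℝ (Fin N) => x + δ • R x) = e := funext fun x => (he x).symm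
  have hinv : Function.invFun e = e.symm := by
    refine funext fun y => e.injective ?_
    rw [e.apply_symm_apply, Function.invFun_eq (e.surjective y)]
  rw [heq, hinv]
  have ha1 : (1 : ℝ≥0) ≤ 1 + t := le_self_add
  have hb1 : (1 : ℝ≥0) ≤ (1 - t)⁻¹ := by
    rw [one_le_inv₀ (tsub_pos_of_lt ht1)]; exact tsub_le_self
  obtain ⟨hpos', hQ⟩ := traceQuotient_image_le (by omega) hΩo hΩb hH1 e ha hb hb1 hed hesd hu hpos
  have hH1' : μH[(N : ℝ) - 1] (frontier (e '' Ω)) < ⊤ := by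
    have hd : (0 : ℝ) ≤ (N : ℝ) - 1 := by
      have : (2 : ℝ) ≤ N := by exact_mod_cast hN
      linarith
    rw [← e.image_frontier]
    exact (ha.hausdorffMeasure_image_le hd _).trans_lt
      (ENNReal.mul_lt_top (ENNReal.rpow_lt_top_of_nonneg hd ENNReal.coe_ne_top) hH1)
  obtain ⟨-, hQ'⟩ := traceQuotient_image_le (by omega) (e.isOpen_image.2 hΩo)
    (ha.isBounded_image hΩb) hH1' e.symm (b := 1 + t) hb (by simpa using ha) ha1 hesd (by simpa using hed) (hu.comp hb) hpos'
  have hcomp : (u ∘ e.symm) ∘ e = u := by ext x; simp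
  have himg : e.symm '' (e '' Ω) = Ω := by rw [← Set.image_comp]; simp
  rw [himg, Homeomorph.symm_symm, hcomp] at hQ'
  rw [mul_comm ((((1 - t)⁻¹ : ℝ≥0) : ℝ))] at hQ'
  set X : ℝ := (((1 + t : ℝ≥0) : ℝ) * ((1 - t)⁻¹ : ℝ≥0)) ^ N
  have hX : X ≤ 1 + 3 ^ N * (4 * M) * |δ| := by
    have h4 : (((1 + t : ℝ≥0) : ℝ) * ((1 - t)⁻¹ : ℝ≥0)) ≤ 1 + 4 * t := by
      rw [NNReal.coe_inv, NNReal.coe_sub ht1.le, NNReal.coe_add, NNReal.coe_one,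
        ← div_eq_mul_inv, div_le_iff₀ (by linarith)]
      nlinarith [t.coe_nonneg]
    calc X ≤ (1 + 4 * t) ^ N := pow_le_pow_left₀ (by positivity) h4 N
      _ ≤ 1 + 3 ^ N * (4 * t) := one_add_pow_le (by positivity) (by linarith) N
      _ = _ := by rw [htδ]; ring
  have hnn : ∀ (D : Set (EuclideanSpace ℝ (Fin N))) v, 0 ≤ traceQuotient D v := fun D v => by
    unfold traceQuotient; positivity
  refine ⟨hpos', ?_, hQ.trans (mul_le_mul_of_nonneg_right hX (hnn _ _))⟩
  set c : ℝ := 3 ^ N * (4 * M) * |δ|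
  have hc : 0 ≤ c := by positivity
  have hQc := hQ'.trans (mul_le_mul_of_nonneg_right hX (hnn _ _))
  rcases le_total c 1 with h1 | h1
  · have := mul_le_mul_of_nonneg_left hQc (sub_nonneg.2 h1)
    nlinarith [mul_nonneg (sq_nonneg c) (hnn (e '' Ω) (u ∘ e.symm))]
  · exact (mul_nonpos_of_nonpos_of_nonneg (by linarith) (hnn _ _)).trans (hnn _ _)
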